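/- arXiv:2308.09645 — 2 statements merged into one kernel-verified Lean document; each statement's English description precedes it below -/
import Mathlib

section
/- For any finite trees T and T', each on at least two vertices, dmg(T □ T') = rad(T □ T') − 1. -/
open SimpleGraph

/-!
Formalization of the game of Cops and Robber (one cop, one robber) and the damage number.

Round 0: the cop chooses a starting vertex, then the robber chooses a starting vertex.
In each subsequent round the cop moves to an adjacent vertex or passes, after which the
robber moves to an adjacent vertex or passes.  Strategies are modelled as functions of
the full history of positions (most recent first).
-/

/-- A cop strategy: an initial vertex together with a move function taking the history of
cop positions (most recent first, nonempty) and of robber positions (most recent first)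
to the cop's next position. -/
structure CopStrategy (V : Type*) where
  init : V
  move : List V → List V → V

/-- A robber strategy: an initial vertex chosen in response to the cop's initial vertex,
together with a move function taking the history of cop positions (most recent first,
including the cop's move from the current round) and of robber positions (most recent
first) to the robber's next position. -/
structure RobberStrategy (V : Type*) where
  init : V → V
  move : List V → List V → V

variable {V : Type*}

/-- A cop move function is legal for `G` if from any position it either passes or
moves along an edge of `G`. -/
def LegalCopMove (G : SimpleGraph V) (cs : List V → List V → V) : Prop :=
  ∀ (c : V) (ch rh : List V), cs (c :: ch) rh = c ∨ G.Adj c (cs (c :: ch) rh)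

/-- A robber move function is legal for `G` if from any position it either passes or
moves along an edge of `G`. -/
def LegalRobMove (G : SimpleGraph V) (rs : List V → List V → V) : Prop :=
  ∀ (r : V) (ch rh : List V), rs ch (r :: rh) = r ∨ G.Adj r (rs ch (r :: rh))

/-- A legal cop strategy: every move passes or goes along an edge. -/
def CopStrategy.Legal (G : SimpleGraph V) (CS : CopStrategy V) : Prop :=
  LegalCopMove G CS.move

/-- A legal robber strategy: every move passes or goes along an edge. -/
def RobberStrategy.Legal (G : SimpleGraph V) (RS : RobberStrategy V) : Prop :=
  LegalRobMove G RS.move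

/-- `play CS RS n = (cₙ, rₙ, earlier cop positions, earlier robber positions)`:
the state of the game after round `n`, when the cop plays `CS` and the robber plays `RS`.
In each round the cop moves first, then the robber moves. -/
def play (CS : CopStrategy V) (RS : RobberStrategy V) : ℕ → V × V × List V × List V
  | 0 => (CS.init, RS.init CS.init, [], [])
  | n + 1 =>
    let p := play CS RS n
    let c := CS.move (p.1 :: p.2.2.1) (p.2.1 :: p.2.2.2)
    let r := RS.move (c :: p.1 :: p.2.2.1) (p.2.1 :: p.2.2.2)
    (c, r, p.1 :: p.2.2.1, p.2.1 :: p.2.2.2)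

/-- The cop's position after its move in round `n`. -/
def copPos (CS : CopStrategy V) (RS : RobberStrategy V) (n : ℕ) : V := (play CS RS n).1

/-- The robber's position after its move in round `n`. -/
def robPos (CS : CopStrategy V) (RS : RobberStrategy V) (n : ℕ) : V := (play CS RS n).2.1

/-- The robber damages `v`: at the end of some round `n` the robber occupies `v`, having
never been captured up to that point (neither by moving onto the cop, nor by the cop's
move in any round up to and including round `n + 1`); it then passes or moves in
round `n + 1`, damaging `v`. -/
def Damages (CS : CopStrategy V) (RS : RobberStrategy V) (v : V) : Prop :=
  ∃ n, robPos CS RS n = v ∧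
    ∀ k ≤ n, copPos CS RS k ≠ robPos CS RS k ∧ copPos CS RS (k + 1) ≠ robPos CS RS k

/-- The set of vertices damaged by the robber during the play of `CS` against `RS`. -/
def damageSet (CS : CopStrategy V) (RS : RobberStrategy V) : Set V :=
  {v | Damages CS RS v}

/-- The damage number of `G`: the minimum over legal cop strategies of the maximum over
legal robber strategies of the number of distinct damaged vertices. -/
noncomputable def dmg (G : SimpleGraph V) : ℕ :=
  sInf { n | ∃ CS : CopStrategy V, CS.Legal G ∧
    ∀ RS : RobberStrategy V, RS.Legal G → (damageSet CS RS).ncard ≤ n }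

/-- A cop strategy passes during the first round. -/
def CopStrategy.PassesFirst (CS : CopStrategy V) : Prop :=
  ∀ r : V, CS.move [CS.init] [r] = CS.init

/-- The damage number of `G` when the cop is required to pass during the first round. -/
noncomputable def dmg' (G : SimpleGraph V) : ℕ :=
  sInf { n | ∃ CS : CopStrategy V, CS.Legal G ∧ CS.PassesFirst ∧
    ∀ RS : RobberStrategy V, RS.Legal G → (damageSet CS RS).ncard ≤ n }

/-- The eccentricity of a vertex: the maximum distance from `u` to any vertex. -/
noncomputable def ecc (G : SimpleGraph V) (u : V) : ℕ := sSup (Set.range (G.dist u))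

/-- The radius of a graph: the minimum eccentricity over all vertices. -/
noncomputable def gRadius (G : SimpleGraph V) : ℕ := sInf (Set.range (ecc G))

/-! ### Auxiliary results -/

theorem play_hist_length (CS : CopStrategy V) (RS : RobberStrategy V) (n : ℕ) :
    (play CS RS n).2.2.2.length = n := by
  induction n with
  | zero => rfl
  | succ n ih => simp [play, ih]

theorem robPos_step {G : SimpleGraph V} (CS : CopStrategy V) (RS : RobberStrategy V)
    (h : RS.Legal G) (n : ℕ) :
    robPos CS RS (n + 1) = robPos CS RS n ∨ G.Adj (robPos CS RS n) (robPos CS RS (n + 1)) :=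
  h _ _ _

theorem copPos_step {G : SimpleGraph V} (CS : CopStrategy V) (RS : RobberStrategy V)
    (h : CS.Legal G) (n : ℕ) :
    copPos CS RS (n + 1) = copPos CS RS n ∨ G.Adj (copPos CS RS n) (copPos CS RS (n + 1)) :=
  h _ _ _

theorem copPos_dist {G : SimpleGraph V} (hG : G.Connected) (CS : CopStrategy V)
    (RS : RobberStrategy V) (h : CS.Legal G) (n : ℕ) :
    G.dist CS.init (copPos CS RS n) ≤ n := by
  induction n with
  | zero => simp [copPos, play]
  | succ n ih =>
    rcases copPos_step CS RS h n with h | h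
    · rw [h]; omega
    · have := hG.dist_triangle (u := CS.init) (v := copPos CS RS n) (w := copPos CS RS (n + 1))
      rw [dist_eq_one_iff_adj.2 h] at this
      omega

theorem exists_geodesic {G : SimpleGraph V} (hG : G.Connected) (u v : V) :
    ∃ f : ℕ → V, (∀ i < G.dist u v, G.Adj (f i) (f (i + 1))) ∧
      ∀ i ≤ G.dist u v, G.dist u (f i) = i := by
  obtain ⟨p, hp⟩ := hG.exists_walk_length_eq_dist u v
  refine ⟨p.getVert, fun i hi => p.adj_getVert_succ (by omega), fun i hi => ?_⟩
  have h1 := dist_le (p.take i)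
  have h2 := dist_le (p.drop i)
  have h3 := hG.dist_triangle (u := u) (v := p.getVert i) (w := v)
  rw [Walk.take_length] at h1
  rw [Walk.drop_length] at h2
  omega

open Classical in
/-- The robber strategy that runs along `f`, starting at `f 2`. -/
noncomputable def runStrat (G : SimpleGraph V) (f : ℕ → V) : RobberStrategy V where
  init _ := f 2
  move _ rh := match rh with
    | [] => f 0
    | r :: t => if G.Adj r (f (t.length + 3)) then f (t.length + 3) else r

theorem runStrat_legal (G : SimpleGraph V) (f : ℕ → V) : (runStrat G f).Legal G := by
  intro r ch rh
  simp only [runStrat]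
  split_ifs with h
  · exact Or.inr h
  · exact Or.inl rfl

theorem runStrat_pos (G : SimpleGraph V) (f : ℕ → V) (CS : CopStrategy V) (R : ℕ)
    (hf : ∀ i < R, G.Adj (f i) (f (i + 1))) (n : ℕ) (hn : n + 2 ≤ R) :
    robPos CS (runStrat G f) n = f (n + 2) := by
  induction n with
  | zero => rfl
  | succ n ih =>
    have h1 := ih (by omega)
    have h2 := play_hist_length CS (runStrat G f) n
    have h3 : robPos CS (runStrat G f) (n + 1) = (runStrat G f).move
      ((play CS (runStrat G f) (n + 1)).1 :: (play CS (runStrat G f) n).1 ::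
        (play CS (runStrat G f) n).2.2.1)
      (robPos CS (runStrat G f) n :: (play CS (runStrat G f) n).2.2.2) := rfl
    rw [h3, h1]
    have h4 : G.Adj (f (n + 2)) (f (n + 3)) := hf (n + 2) (by omega)
    generalize (play CS (runStrat G f) n).2.2.2 = l at h2
    subst h2
    simp only [runStrat, if_pos h4]

theorem lower_bound [Finite V] {G : SimpleGraph V} (hG : G.Connected) (CS : CopStrategy V)
    (h : CS.Legal G) (v : V) :
    ∃ RS : RobberStrategy V, RS.Legal G ∧
      G.dist CS.init v - 1 ≤ (damageSet CS RS).ncard := by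
  obtain ⟨f, hf, hd⟩ := exists_geodesic hG CS.init v
  refine ⟨runStrat G f, runStrat_legal G f, ?_⟩
  set R := G.dist CS.init v
  have hsub : f '' (Set.Icc 2 R) ⊆ damageSet CS (runStrat G f) := by
    rintro _ ⟨i, ⟨hi1, hi2⟩, rfl⟩
    refine ⟨i - 2, ?_, fun k hk => ?_⟩
    · rw [runStrat_pos G f CS R hf _ (by omega)]
      congr 1; omega
    · rw [runStrat_pos G f CS R hf k (by omega)]
      have h0 := hd (k + 2) (by omega)
      have h1 := copPos_dist hG CS (runStrat G f) h k
      have h2 := copPos_dist hG CS (runStrat G f) h (k + 1)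
      constructor
      · intro e; rw [e] at h1; omega
      · intro e; rw [e] at h2; omega
  have hinj : Set.InjOn f (Set.Icc 2 R) := by
    intro i hi j hj e
    rw [← hd i hi.2, ← hd j hj.2, e]
  have h1 := Set.ncard_le_ncard hsub (Set.toFinite _)
  rw [hinj.ncard_image] at h1
  have h2 : (Set.Icc 2 R).ncard = R - 1 := by
    rw [← Finset.coe_Icc, Set.ncard_coe_finset, Nat.card_Icc]; omega
  omega

/-! ### Trees -/

theorem tree_parent_unique {G : SimpleGraph V} (hG : G.IsTree) {o r w w' : V}
    (h : G.Adj w r) (h' : G.Adj w' r) (hd : G.dist o w + 1 = G.dist o r)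
    (hd' : G.dist o w' + 1 = G.dist o r) : w = w' := by
  obtain ⟨p, hp⟩ := hG.connected.exists_walk_length_eq_dist o w
  obtain ⟨q, hq⟩ := hG.connected.exists_walk_length_eq_dist o w'
  have hp' := (p.concat h).isPath_of_length_eq_dist (by rw [Walk.length_concat]; omega)
  have hq' := (q.concat h').isPath_of_length_eq_dist (by rw [Walk.length_concat]; omega)
  have e := congrArg Subtype.val (hG.isAcyclic.path_unique ⟨_, hp'⟩ ⟨_, hq'⟩)
  have e2 := congrArg Walk.penultimate e
  simpa using e2

theorem exists_closer {G : SimpleGraph V} (hG : G.Connected) {u v : V} (h : u ≠ v) :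
    ∃ w, G.Adj u w ∧ G.dist w v + 1 = G.dist u v := by
  obtain ⟨f, hf, hd⟩ := exists_geodesic hG v u
  have hpos := hG.pos_dist_of_ne h.symm
  have e : G.dist v u - 1 + 1 = G.dist v u := by omega
  obtain ⟨p, hp⟩ := hG.exists_walk_length_eq_dist u v
  cases p with
  | nil => exact absurd rfl h
  | cons ha q =>
    rename_i w
    refine ⟨w, ha, ?_⟩
    have h1 := dist_le q
    have h2 := hG.dist_triangle (u := u) (v := w) (w := v)
    rw [dist_eq_one_iff_adj.2 ha] at h2
    rw [Walk.length_cons] at hp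
    omega

/-- `c` lies on the geodesic from `o` to `r`. -/
def OnGeo (G : SimpleGraph V) (o c r : V) : Prop := G.dist o c + G.dist c r = G.dist o r

theorem OnGeo.robber {G : SimpleGraph V} (hG : G.IsTree) {o c r r' : V} (hB : OnGeo G o c r)
    (ha : G.Adj r r') (hne : c ≠ r) : OnGeo G o c r' := by
  unfold OnGeo at *
  have t1 := hG.connected.dist_triangle (u := o) (v := c) (w := r')
  rcases hG.dist_eq_dist_add_one_of_adj o ha with h | h
  · obtain ⟨w, hw, hd⟩ := exists_closer hG.connected hne.symm
    have t2 := hG.connected.dist_triangle (u := o) (v := c) (w := w)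
    have t3 := hG.connected.dist_triangle (u := o) (v := w) (w := r)
    rw [dist_eq_one_iff_adj.2 hw.symm] at t3
    rw [G.dist_comm (u := w), G.dist_comm (u := r)] at hd
    have : w = r' := tree_parent_unique hG hw.symm ha.symm (o := o) (by omega) (by omega)
    subst this
    omega
  · have t2 := hG.connected.dist_triangle (u := c) (v := r) (w := r')
    rw [dist_eq_one_iff_adj.2 ha] at t2
    omega

theorem OnGeo.cop {G : SimpleGraph V} (hG : G.Connected) {o c c' r : V} (hB : OnGeo G o c r)
    (ha : G.Adj c c') (hd : G.dist c' r + 1 = G.dist c r) :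
    OnGeo G o c' r ∧ G.dist o c' = G.dist o c + 1 := by
  unfold OnGeo at *
  have t1 := hG.dist_triangle (u := o) (v := c) (w := c')
  have t2 := hG.dist_triangle (u := o) (v := c') (w := r)
  rw [dist_eq_one_iff_adj.2 ha] at t1
  omega

open Classical in
/-- A neighbour of `u` that is closer to `v` (or `u` itself). -/
noncomputable def nxt (G : SimpleGraph V) (u v : V) : V :=
  if h : ∃ w, G.Adj u w ∧ G.dist w v + 1 = G.dist u v then h.choose else u

theorem nxt_spec {G : SimpleGraph V} (hG : G.Connected) {u v : V} (h : u ≠ v) :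
    G.Adj u (nxt G u v) ∧ G.dist (nxt G u v) v + 1 = G.dist u v := by
  have h := exists_closer hG h
  rw [nxt, dif_pos h]
  exact h.choose_spec

theorem nxt_legal (G : SimpleGraph V) (u v : V) : nxt G u v = u ∨ G.Adj u (nxt G u v) := by
  unfold nxt
  split_ifs with h
  · exact Or.inr h.choose_spec.1
  · exact Or.inl rfl

section Upper

variable {α β : Type*}

/-- The cop's reply: pass if the two coordinate distances agree, otherwise approach in the
coordinate with the larger distance. -/
noncomputable def copStep (T : SimpleGraph α) (T' : SimpleGraph β) (c r : α × β) : α × β :=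
  if T.dist c.1 r.1 = T'.dist c.2 r.2 then c
  else if T'.dist c.2 r.2 < T.dist c.1 r.1 then (nxt T c.1 r.1, c.2)
  else (c.1, nxt T' c.2 r.2)

open SimpleGraph

/-- The positional cop strategy given by `copStep`. -/
noncomputable def copStrat (T : SimpleGraph α) (T' : SimpleGraph β) (o : α × β) :
    CopStrategy (α × β) where
  init := o
  move ch rh := match ch, rh with
    | c :: _, r :: _ => copStep T T' c r
    | c :: _, [] => c
    | [], _ => o

theorem copStrat_legal (T : SimpleGraph α) (T' : SimpleGraph β) (o : α × β) :
    (copStrat T T' o).Legal (T □ T') := by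
  intro c ch rh
  cases rh with
  | nil => exact Or.inl rfl
  | cons r rh =>
    change copStep T T' c r = c ∨ (T □ T').Adj c (copStep T T' c r)
    unfold copStep
    split_ifs
    · exact Or.inl rfl
    · rcases nxt_legal T c.1 r.1 with h | h
      · left; rw [h]
      · right; simp [boxProd_adj, h]
    · rcases nxt_legal T' c.2 r.2 with h | h
      · left; rw [h]
      · right; simp [boxProd_adj, h]

/-- State after the cop's move, with `m` vertices visited by the robber. -/
def InvC (T : SimpleGraph α) (T' : SimpleGraph β) (o c r : α × β) (m : ℕ) : Prop :=
  OnGeo T o.1 c.1 r.1 ∧ OnGeo T' o.2 c.2 r.2 ∧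
  ((T.dist c.1 r.1 = T'.dist c.2 r.2 ∧ m ≤ T.dist o.1 c.1 + T'.dist o.2 c.2 + 1) ∨
   (T'.dist c.2 r.2 < T.dist c.1 r.1 ∧ c.2 = o.2 ∧ m ≤ T.dist o.1 c.1 + T'.dist o.2 c.2) ∨
   (T.dist c.1 r.1 < T'.dist c.2 r.2 ∧ c.1 = o.1 ∧ m ≤ T.dist o.1 c.1 + T'.dist o.2 c.2))

open SimpleGraph

/-- State after the robber's move, with `m` vertices visited by the robber. -/
def InvR (T : SimpleGraph α) (T' : SimpleGraph β) (o c r : α × β) (m : ℕ) : Prop :=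
  OnGeo T o.1 c.1 r.1 ∧ OnGeo T' o.2 c.2 r.2 ∧
  ((T.dist c.1 r.1 = T'.dist c.2 r.2 ∧ m ≤ T.dist o.1 c.1 + T'.dist o.2 c.2 + 1) ∨
   (T'.dist c.2 r.2 < T.dist c.1 r.1 ∧ c.2 = o.2 ∧ m ≤ T.dist o.1 c.1 + T'.dist o.2 c.2 + 1) ∨
   (T.dist c.1 r.1 < T'.dist c.2 r.2 ∧ c.1 = o.1 ∧ m ≤ T.dist o.1 c.1 + T'.dist o.2 c.2 + 1) ∨
   ((T.dist c.1 r.1 = T'.dist c.2 r.2 + 1 ∨ T'.dist c.2 r.2 = T.dist c.1 r.1 + 1) ∧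
      m ≤ T.dist o.1 c.1 + T'.dist o.2 c.2 + 2))

theorem InvR.step {T : SimpleGraph α} {T' : SimpleGraph β} (hT : T.IsTree) (hT' : T'.IsTree)
    {o c r : α × β} {m : ℕ} (h : InvR T T' o c r m) : InvC T T' o (copStep T T' c r) r m := by
  obtain ⟨h1, h2, h3⟩ := h
  unfold copStep
  split_ifs with e1 e2
  · exact ⟨h1, h2, by omega⟩
  · have hne : c.1 ≠ r.1 := by
      intro e; rw [e, SimpleGraph.dist_self] at e2; omega
    obtain ⟨s1, s2⟩ := nxt_spec hT.connected hne
    obtain ⟨b1, b2⟩ := h1.cop hT.connected s1 s2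
    refine ⟨b1, h2, ?_⟩
    dsimp only
    by_cases hq : c.2 = o.2
    · simp only [hq, true_and] at *
      omega
    · simp only [hq, false_and, and_false, false_or, or_false] at *
      omega
  · have hne : c.2 ≠ r.2 := by
      intro e; rw [e, SimpleGraph.dist_self] at e1 e2; omega
    obtain ⟨s1, s2⟩ := nxt_spec hT'.connected hne
    obtain ⟨b1, b2⟩ := h2.cop hT'.connected s1 s2
    refine ⟨h1, b1, ?_⟩
    dsimp only
    by_cases hq : c.1 = o.1
    · simp only [hq, true_and] at *
      omega
    · simp only [hq, false_and, and_false, false_or, or_false] at *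
      omega

theorem InvC.mono {T : SimpleGraph α} {T' : SimpleGraph β} 
    {o c r : α × β} {m m' : ℕ} (h : InvC T T' o c r m) (hm : m' ≤ m) : InvR T T' o c r m' := by
  obtain ⟨h1, h2, h3⟩ := h
  refine ⟨h1, h2, ?_⟩
  rcases h3 with ⟨x, y⟩ | ⟨x, z, y⟩ | ⟨x, z, y⟩
  · left; omega
  · right; left; exact ⟨x, z, by omega⟩
  · right; right; left; exact ⟨x, z, by omega⟩

theorem InvC.stepR {T : SimpleGraph α} {T' : SimpleGraph β} (hT : T.IsTree) (hT' : T'.IsTree)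
    {o c r r' : α × β} {m m' : ℕ} (h : InvC T T' o c r m) (hne : c ≠ r)
    (ha : (T □ T').Adj r r') (hm : m' ≤ m + 1) : InvR T T' o c r' m' := by
  obtain ⟨h1, h2, h3⟩ := h
  have triv : ∀ x, OnGeo T o.1 o.1 x := fun x => by simp [OnGeo]
  have triv' : ∀ x, OnGeo T' o.2 o.2 x := fun x => by simp [OnGeo]
  have hne' : T.dist c.1 r.1 ≠ 0 ∨ T'.dist c.2 r.2 ≠ 0 := by
    by_contra hcon
    push Not at hcon
    exact hne (Prod.ext (hT.connected.dist_eq_zero_iff.1 hcon.1)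
      (hT'.connected.dist_eq_zero_iff.1 hcon.2))
  have n1 : T.dist c.1 r.1 ≠ 0 → c.1 ≠ r.1 := fun h e => h (by rw [e, SimpleGraph.dist_self])
  have n2 : T'.dist c.2 r.2 ≠ 0 → c.2 ≠ r.2 := fun h e => h (by rw [e, SimpleGraph.dist_self])
  rw [boxProd_adj] at ha
  rcases ha with ⟨ha, e⟩ | ⟨ha, e⟩
  · have hd := hT.dist_eq_dist_add_one_of_adj c.1 ha
    have hB : OnGeo T o.1 c.1 r'.1 := by
      rcases h3 with ⟨x, y⟩ | ⟨x, z, y⟩ | ⟨x, z, y⟩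
      · exact h1.robber hT ha (n1 (by omega))
      · exact h1.robber hT ha (n1 (by omega))
      · rw [z]; exact triv _
    refine ⟨hB, e ▸ h2, ?_⟩
    rw [← e]
    rcases h3 with ⟨x, y⟩ | ⟨x, z, y⟩ | ⟨x, z, y⟩
    · omega
    · simp only [z, true_and] at *; omega
    · simp only [z, true_and] at *; omega
  · have hd := hT'.dist_eq_dist_add_one_of_adj c.2 ha
    have hB : OnGeo T' o.2 c.2 r'.2 := by
      rcases h3 with ⟨x, y⟩ | ⟨x, z, y⟩ | ⟨x, z, y⟩
      · exact h2.robber hT' ha (n2 (by omega))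
      · rw [z]; exact triv' _
      · exact h2.robber hT' ha (n2 (by omega))
    refine ⟨e ▸ h1, hB, ?_⟩
    rw [← e]
    rcases h3 with ⟨x, y⟩ | ⟨x, z, y⟩ | ⟨x, z, y⟩
    · omega
    · simp only [z, true_and] at *; omega
    · simp only [z, true_and] at *; omega

open Classical in
/-- The vertices visited by the robber up to round `n`. -/
noncomputable def visited (CS : CopStrategy V) (RS : RobberStrategy V) (n : ℕ) : Finset V :=
  (Finset.range (n + 1)).image (robPos CS RS)

theorem visited_succ_card (CS : CopStrategy V) (RS : RobberStrategy V) (n : ℕ) :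
    (visited CS RS (n + 1)).card ≤ (visited CS RS n).card + 1 := by
  classical
  unfold visited
  rw [Finset.range_add_one, Finset.image_insert]
  exact Finset.card_insert_le _ _

theorem visited_succ_card_of_pass (CS : CopStrategy V) (RS : RobberStrategy V) (n : ℕ)
    (h : robPos CS RS (n + 1) = robPos CS RS n) :
    (visited CS RS (n + 1)).card ≤ (visited CS RS n).card := by
  classical
  unfold visited
  rw [Finset.range_add_one, Finset.image_insert, h, Finset.insert_eq_of_mem]
  exact Finset.mem_image_of_mem _ (by simp)

theorem play_inv {T : SimpleGraph α} {T' : SimpleGraph β} (hT : T.IsTree) (hT' : T'.IsTree)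
    (o : α × β) (RS : RobberStrategy (α × β)) (hRS : RS.Legal (T □ T')) (n : ℕ)
    (h : ∀ k ≤ n, copPos (copStrat T T' o) RS k ≠ robPos (copStrat T T' o) RS k ∧
      copPos (copStrat T T' o) RS (k + 1) ≠ robPos (copStrat T T' o) RS k) :
    InvC T T' o (copPos (copStrat T T' o) RS (n + 1)) (robPos (copStrat T T' o) RS n)
      (visited (copStrat T T' o) RS n).card := by
  have key : ∀ n, copPos (copStrat T T' o) RS (n + 1) =
      copStep T T' (copPos (copStrat T T' o) RS n) (robPos (copStrat T T' o) RS n) :=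
    fun n => rfl
  induction n with
  | zero =>
    rw [key]
    apply InvR.step hT hT'
    have h0 : copPos (copStrat T T' o) RS 0 = o := rfl
    have hv : (visited (copStrat T T' o) RS 0).card = 1 := by simp [visited]
    rw [h0, hv]
    refine ⟨by simp [OnGeo], by simp [OnGeo], ?_⟩
    simp only [true_and, SimpleGraph.dist_self]
    omega
  | succ n ih =>
    have ih := ih (fun k hk => h k (by omega))
    rw [key]
    apply InvR.step hT hT'
    rcases robPos_step (copStrat T T' o) RS hRS n with e | e
    · have hc := visited_succ_card_of_pass _ _ _ e
      rw [e]
      exact ih.mono hc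
    · exact ih.stepR hT hT' (h n (by omega)).2 e (visited_succ_card _ _ _)

theorem dist_boxProd_add {T : SimpleGraph α} {T' : SimpleGraph β} (hT : T.Connected)
    (hT' : T'.Connected) (x y : α × β) :
    (T □ T').dist x y = T.dist x.1 y.1 + T'.dist x.2 y.2 := by
  have h := edist_boxProd (G := T) (H := T') x y
  rw [← (hT x.1 y.1).coe_dist_eq_edist, ← (hT' x.2 y.2).coe_dist_eq_edist,
    ← ((hT.boxProd hT') x y).coe_dist_eq_edist] at h
  exact_mod_cast h

theorem upper_bound [Finite α] [Finite β] {T : SimpleGraph α} {T' : SimpleGraph β}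
    (hT : T.IsTree) (hT' : T'.IsTree) (o : α × β) (R : ℕ) (hR : ∀ v, (T □ T').dist o v ≤ R)
    (RS : RobberStrategy (α × β)) (hRS : RS.Legal (T □ T')) :
    (damageSet (copStrat T T' o) RS).ncard ≤ R - 1 := by
  set CS := copStrat T T' o with hCS
  have hfin : (damageSet CS RS).Finite := Set.toFinite _
  rcases (damageSet CS RS).eq_empty_or_nonempty with he | ⟨v0, hv0⟩
  · simp [he]
  have hch : ∀ v : α × β, ∃ n, v ∈ damageSet CS RS → robPos CS RS n = v ∧
    ∀ k ≤ n, copPos CS RS k ≠ robPos CS RS k ∧ copPos CS RS (k + 1) ≠ robPos CS RS k := by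
    intro v
    by_cases hv : v ∈ damageSet CS RS
    · obtain ⟨n, hn⟩ := hv
      exact ⟨n, fun _ => hn⟩
    · exact ⟨0, fun h => absurd h hv⟩
  choose t ht using hch
  obtain ⟨w, hw, hmax⟩ := Set.exists_max_image (damageSet CS RS) t hfin ⟨v0, hv0⟩
  have hsub : damageSet CS RS ⊆ (visited CS RS (t w) : Set (α × β)) := by
    classical
    intro v hv
    have h1 := hmax v hv
    simp only [visited, Finset.mem_coe, Finset.mem_image, Finset.mem_range]
    exact ⟨t v, by omega, (ht v hv).1⟩
  have hcard := Set.ncard_le_ncard hsub (Finset.finite_toSet _)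
  rw [Set.ncard_coe_finset] at hcard
  obtain ⟨b1, b2, h3⟩ := play_inv hT hT' o RS hRS (t w) (ht w hw).2
  have hne := ((ht w hw).2 (t w) le_rfl).2
  rw [← hCS] at b1 b2 h3
  have hd := hR (robPos CS RS (t w))
  rw [dist_boxProd_add hT.connected hT'.connected] at hd
  generalize copPos CS RS (t w + 1) = c at *
  generalize robPos CS RS (t w) = r at *
  have hne' : T.dist c.1 r.1 ≠ 0 ∨ T'.dist c.2 r.2 ≠ 0 := by
    by_contra hcon
    push Not at hcon
    exact hne (Prod.ext (hT.connected.dist_eq_zero_iff.1 hcon.1)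
      (hT'.connected.dist_eq_zero_iff.1 hcon.2))
  unfold OnGeo at b1 b2
  omega

end Upper

/-- For any finite trees `T` and `T'` on at least two vertices,
`dmg(T □ T') = rad(T □ T') - 1`. -/
theorem dmg_boxProd_trees {α β : Type*} [Fintype α] [Fintype β]
    (T : SimpleGraph α) (T' : SimpleGraph β) (hT : T.IsTree) (hT' : T'.IsTree)
    (h2 : 2 ≤ Fintype.card α) (h2' : 2 ≤ Fintype.card β) :
    dmg (T □ T') = gRadius (T □ T') - 1 := by
  have hc : (T □ T').Connected := hT.connected.boxProd hT'.connected
  have := hc.nonempty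
  have hbdd : ∀ u, BddAbove (Set.range ((T □ T').dist u)) := fun u => (Set.finite_range _).bddAbove
  obtain ⟨o, ho⟩ : gRadius (T □ T') ∈ Set.range (ecc (T □ T')) :=
    Nat.sInf_mem (Set.range_nonempty _)
  have hmem : gRadius (T □ T') - 1 ∈ { n | ∃ CS : CopStrategy (α × β), CS.Legal (T □ T') ∧
      ∀ RS : RobberStrategy (α × β), RS.Legal (T □ T') → (damageSet CS RS).ncard ≤ n } := by
    refine ⟨copStrat T T' o, copStrat_legal T T' o, fun RS hRS => ?_⟩
    refine upper_bound hT hT' o _ (fun v => ?_) RS hRS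
    rw [← ho]
    exact le_csSup (hbdd o) ⟨v, rfl⟩
  refine le_antisymm (Nat.sInf_le hmem) ?_
  refine le_csInf ⟨_, hmem⟩ ?_
  rintro n ⟨CS, hCS, hn⟩
  obtain ⟨v, hv⟩ : ecc (T □ T') CS.init ∈ Set.range ((T □ T').dist CS.init) :=
    Nat.sSup_mem (Set.range_nonempty _) (hbdd _)
  have hle : gRadius (T □ T') ≤ ecc (T □ T') CS.init := Nat.sInf_le ⟨_, rfl⟩
  obtain ⟨RS, hRS, hd⟩ := lower_bound hc CS hCS v
  have := hn RS hRS
  omega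
end

section
/- For any m ≥ 4, dmg'(C_m) = dmg(C_m) if m is odd, and dmg'(C_m) = dmg(C_m) + 1 if m is even. Furthermore, when m is even, if the robber's starting vertex is not adjacent to the cop's starting vertex and the cop passes during the first round, the cop can prevent the robber from damaging more than dmg(C_m) vertices. -/
open SimpleGraph

variable {V : Type*}

/-- Reduction of an integer modulo `m`, as a vertex of the cycle. -/
def emod (m : ℕ) [NeZero m] (z : ℤ) : Fin m :=
  ⟨(z % (m : ℤ)).toNat, by
    have h : (0 : ℤ) < m := by exact_mod_cast Nat.pos_of_ne_zero (NeZero.ne m)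
    have h1 := Int.emod_nonneg z h.ne'
    have h2 := Int.emod_lt_of_pos z h
    omega⟩

section aux
variable {m : ℕ} [NeZero m]

lemma m_pos' : (0 : ℤ) < m := by exact_mod_cast Nat.pos_of_ne_zero (NeZero.ne m)

lemma emod_val (z : ℤ) : ((emod m z).val : ℤ) = z % m := by
  have h1 := Int.emod_nonneg z (m_pos' (m := m)).ne'
  simp [emod, h1]

lemma emod_eq_iff {a b : ℤ} : emod m a = emod m b ↔ (m : ℤ) ∣ a - b := by
  rw [← Int.modEq_iff_dvd, Int.ModEq, Fin.ext_iff, ← emod_val, ← emod_val]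
  omega

lemma emod_self (v : Fin m) : emod m (v.val : ℤ) = v := by
  apply Fin.ext
  have := emod_val (m := m) (v.val : ℤ)
  rw [Int.emod_eq_of_lt (by omega) (by exact_mod_cast v.2)] at this
  exact_mod_cast this

lemma emod_val_dvd (z : ℤ) : (m : ℤ) ∣ ((emod m z).val : ℤ) - z :=
  emod_eq_iff.1 (emod_self _)

lemma emod_ne {a b : ℤ} (h1 : 0 < a - b) (h2 : a - b < m) : emod m b ≠ emod m a := by
  intro h
  have := Int.le_of_dvd h1 (emod_eq_iff.1 h.symm)
  omega

lemma adj_emod (hm : 4 ≤ m) {a b : ℤ} : (cycleGraph m).Adj (emod m a) (emod m b) ↔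
    (m : ℤ) ∣ a - b - 1 ∨ (m : ℤ) ∣ b - a - 1 := by
  have key : ∀ a b : ℤ, (emod m a - emod m b).val = 1 ↔ (m : ℤ) ∣ a - b - 1 := by
    intro a b
    have h1 : ((emod m a - emod m b).val : ℤ) = (a - b) % m := by
      rw [Fin.sub_def]
      have hb := (emod m b).2
      push_cast [Nat.cast_sub hb.le]
      rw [emod_val, emod_val]
      apply Int.emod_emod_of_dvd _ (dvd_refl _) |>.symm.trans
      rw [Int.emod_emod_of_dvd _ (dvd_refl _)]
      apply Int.ModEq.symm
      rw [Int.modEq_iff_dvd]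
      have e1 := Int.emod_add_mul_ediv a m
      have e2 := Int.emod_add_mul_ediv b m
      refine ⟨1 + b / m - a / m, ?_⟩
      linear_combination e1 - e2
    rw [← Int.modEq_iff_dvd (a := 1), Int.ModEq, ← h1, Int.emod_eq_of_lt (by omega) (by omega)]
    omega
  rw [cycleGraph_adj', key, key]

lemma step_lift (hm : 4 ≤ m) {a : ℤ} {v : Fin m}
    (h : v = emod m a ∨ (cycleGraph m).Adj (emod m a) v) :
    ∃ b : ℤ, a - 1 ≤ b ∧ b ≤ a + 1 ∧ v = emod m b := by
  rcases h with h | h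
  · exact ⟨a, by omega, by omega, h⟩
  · rw [← emod_self v, adj_emod hm] at h
    rcases h with h | h
    · refine ⟨a - 1, by omega, by omega, ?_⟩
      rw [← emod_self v, emod_eq_iff]
      obtain ⟨w, hw⟩ := h
      exact ⟨-w, by linarith⟩
    · refine ⟨a + 1, by omega, by omega, ?_⟩
      rw [← emod_self v, emod_eq_iff]
      obtain ⟨w, hw⟩ := h
      exact ⟨w, by linarith⟩

lemma step_emod (hm : 4 ≤ m) {a b : ℤ} (h1 : a - 1 ≤ b) (h2 : b ≤ a + 1) :
    emod m b = emod m a ∨ (cycleGraph m).Adj (emod m a) (emod m b) := by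
  rw [adj_emod hm]
  rcases (by omega : b = a ∨ a - b - 1 = 0 ∨ b - a - 1 = 0) with h | h | h
  · left; rw [h]
  · right; left; rw [h]; simp
  · right; right; rw [h]; simp

lemma seq_lift (hm : 4 ≤ m) (c : ℕ → Fin m) (a : ℤ) (h0 : c 0 = emod m a)
    (h : ∀ n, c (n + 1) = c n ∨ (cycleGraph m).Adj (c n) (c (n + 1))) :
    ∃ C : ℕ → ℤ, C 0 = a ∧ (∀ n, c n = emod m (C n)) ∧
      ∀ n, C n - 1 ≤ C (n + 1) ∧ C (n + 1) ≤ C n + 1 := by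
  have : ∀ n (x : ℤ), ∃ y : ℤ, c n = emod m x → x - 1 ≤ y ∧ y ≤ x + 1 ∧ c (n + 1) = emod m y := by
    intro n x
    by_cases hx : c n = emod m x
    · obtain ⟨b, hb⟩ := step_lift hm (hx ▸ h n)
      exact ⟨b, fun _ => hb⟩
    · exact ⟨0, fun h => absurd h hx⟩
  choose F hF using this
  let C : ℕ → ℤ := fun n => Nat.rec a F n
  have hC : ∀ n, C (n + 1) = F n (C n) := fun n => rfl
  have h1 : ∀ n, c n = emod m (C n) := by
    intro n
    induction n with
    | zero => exact h0
    | succ n ih => rw [hC]; exact (hF n _ ih).2.2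
  refine ⟨C, rfl, h1, fun n => ?_⟩
  rw [hC]
  exact ⟨(hF n _ (h1 n)).1, (hF n _ (h1 n)).2.1⟩

lemma ncard_ge (s : Set (Fin m)) (a : ℤ) (K : ℕ) (hK : K ≤ m)
    (h : ∀ i : ℕ, i < K → emod m (a + i) ∈ s) : K ≤ s.ncard := by
  have h1 : ((Finset.range K).image (fun i : ℕ => emod m (a + i))).card = K := by
    rw [Finset.card_image_of_injOn, Finset.card_range]
    intro i hi j hj hij
    simp only [Finset.coe_range, Set.mem_Iio] at hi hj
    by_contra hne
    rcases lt_or_gt_of_ne hne with hlt | hlt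
    · exact emod_ne (by omega) (by omega) hij
    · exact emod_ne (by omega) (by omega) hij.symm
  rw [← h1, ← Set.ncard_coe_finset]
  apply Set.ncard_le_ncard _ (Set.toFinite _)
  intro x hx
  simp only [Finset.coe_image, Finset.coe_range, Set.mem_image, Set.mem_Iio] at hx
  obtain ⟨i, hi, rfl⟩ := hx
  exact h i hi

lemma ncard_le' (s : Set (Fin m)) (a b : ℤ) (K : ℕ) (hK : b - a + 1 ≤ K)
    (h : ∀ v ∈ s, ∃ x : ℤ, a ≤ x ∧ x ≤ b ∧ v = emod m x) : s.ncard ≤ K := by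
  have h1 : s ⊆ ((Finset.Icc a b).image (emod m) : Finset (Fin m)) := by
    intro v hv
    obtain ⟨x, h1, h2, rfl⟩ := h v hv
    simp only [Finset.coe_image, Finset.coe_Icc, Set.mem_image, Set.mem_Icc]
    exact ⟨x, ⟨h1, h2⟩, rfl⟩
  have h2 := Set.ncard_le_ncard h1 (Set.toFinite _)
  rw [Set.ncard_coe_finset] at h2
  have h3 := Finset.card_image_le (s := Finset.Icc a b) (f := emod m)
  rw [Int.card_Icc] at h3
  omega

/-! ### Playing -/

lemma cop_step {G : SimpleGraph V} {CS : CopStrategy V} (h : CS.Legal G) (RS : RobberStrategy V)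
    (n : ℕ) : copPos CS RS (n + 1) = copPos CS RS n ∨
      G.Adj (copPos CS RS n) (copPos CS RS (n + 1)) := h _ _ _

lemma rob_step {G : SimpleGraph V} {RS : RobberStrategy V} (h : RS.Legal G) (CS : CopStrategy V)
    (n : ℕ) : robPos CS RS (n + 1) = robPos CS RS n ∨
      G.Adj (robPos CS RS n) (robPos CS RS (n + 1)) := h _ _ _

/-! ### Upper bounds: mirroring cop -/

open Classical in
/-- Move to the target if legal, else pass. -/
noncomputable def guardMove (c t : Fin m) : Fin m :=
  if t = c ∨ (cycleGraph m).Adj c t then t else c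

lemma guardMove_legal (c t : Fin m) :
    guardMove c t = c ∨ (cycleGraph m).Adj c (guardMove c t) := by
  unfold guardMove
  split_ifs with h
  · exact h
  · left; rfl

lemma guardMove_eq (hm : 4 ≤ m) {a b : ℤ} (h1 : a - 1 ≤ b) (h2 : b ≤ a + 1) :
    guardMove (emod m a) (emod m b) = emod m b := by
  unfold guardMove
  rw [if_pos (step_emod hm h1 h2)]

/-- The mirroring cop: prescribed first two moves, then mirror the last robber move. -/
noncomputable def mirrorCop (m : ℕ) [NeZero m] (f : Fin m → Fin m) (g : Fin m → Fin m → Fin m) :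
    CopStrategy (Fin m) where
  init := emod m 0
  move := fun ch rh => match ch, rh with
    | c :: _, [r0] => guardMove c (f r0)
    | c :: _, [r1, r0] => guardMove c (g r0 r1)
    | c :: _, r' :: r :: _ => guardMove c (emod m ((c.val : ℤ) + r.val - r'.val))
    | c :: _, [] => c
    | [], _ => emod m 0

lemma mirrorCop_legal (f : Fin m → Fin m) (g : Fin m → Fin m → Fin m) :
    (mirrorCop m f g).Legal (cycleGraph m) := by
  intro c ch rh
  match rh with
  | [] => left; rfl
  | [r0] => exact guardMove_legal _ _
  | [r1, r0] => exact guardMove_legal _ _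
  | r' :: r :: q :: l => exact guardMove_legal _ _

lemma mirrorCop_one (f : Fin m → Fin m) (g : Fin m → Fin m → Fin m) (RS : RobberStrategy (Fin m)) :
    copPos (mirrorCop m f g) RS 1 =
      guardMove (emod m 0) (f (robPos (mirrorCop m f g) RS 0)) := rfl

lemma mirrorCop_two (f : Fin m → Fin m) (g : Fin m → Fin m → Fin m) (RS : RobberStrategy (Fin m)) :
    copPos (mirrorCop m f g) RS 2 =
      guardMove (copPos (mirrorCop m f g) RS 1)
        (g (robPos (mirrorCop m f g) RS 0) (robPos (mirrorCop m f g) RS 1)) := rfl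

lemma mirrorCop_succ (f : Fin m → Fin m) (g : Fin m → Fin m → Fin m) (RS : RobberStrategy (Fin m))
    (n : ℕ) :
    copPos (mirrorCop m f g) RS (n + 3) =
      guardMove (copPos (mirrorCop m f g) RS (n + 2))
        (emod m (((copPos (mirrorCop m f g) RS (n + 2)).val : ℤ)
          + (robPos (mirrorCop m f g) RS (n + 1)).val
          - (robPos (mirrorCop m f g) RS (n + 2)).val)) := rfl

lemma mirrorCop_mirror (hm : 4 ≤ m) (f : Fin m → Fin m) (g : Fin m → Fin m → Fin m)
    (RS : RobberStrategy (Fin m)) (R : ℕ → ℤ)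
    (hr : ∀ n, robPos (mirrorCop m f g) RS n = emod m (R n))
    (hR : ∀ n, R n - 1 ≤ R (n + 1) ∧ R (n + 1) ≤ R n + 1) (S : ℤ)
    (h2 : copPos (mirrorCop m f g) RS 2 = emod m (S - R 1)) (n : ℕ) :
    copPos (mirrorCop m f g) RS (n + 2) = emod m (S - R (n + 1)) := by
  induction n with
  | zero => exact h2
  | succ n ih =>
    rw [show n + 1 + 2 = n + 3 from rfl, mirrorCop_succ, ih, hr, hr]
    have : emod m (((emod m (S - R (n + 1))).val : ℤ) + (emod m (R (n + 1))).val
        - (emod m (R (n + 2))).val) = emod m (S - R (n + 2)) := by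
      rw [emod_eq_iff]
      have h1 := emod_val_dvd (m := m) (S - R (n + 1))
      have h2 := emod_val_dvd (m := m) (R (n + 1))
      have h3 := emod_val_dvd (m := m) (R (n + 2))
      have h4 := dvd_sub (dvd_add h1 h2) h3
      obtain ⟨w, hw⟩ := h4
      exact ⟨w, by linarith⟩
    rw [this]
    have := hR (n + 1)
    rw [show n + 1 + 1 = n + 2 from rfl] at this
    exact guardMove_eq hm (by omega) (by omega)

/-- Confinement: a mirrored robber stays strictly inside one half. -/
lemma confine (c r : ℕ → Fin m) (R : ℕ → ℤ) (hr : ∀ n, r n = emod m (R n))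
    (hR : ∀ n, R n - 1 ≤ R (n + 1) ∧ R (n + 1) ≤ R n + 1) (S : ℤ) (N : ℕ)
    (hc : ∀ n, N ≤ n → c (n + 1) = emod m (S - R n)) :
    ∃ a : ℤ, (m : ℤ) ∣ a ∧ ∀ n, N ≤ n → (∀ k ≤ n, c k ≠ r k ∧ c (k + 1) ≠ r k) →
      a < 2 * R n - S ∧ 2 * R n - S < a + m := by
  have hpos := m_pos' (m := m)
  set a : ℤ := m * ((2 * R N - S) / m) with ha
  have hd : (m : ℤ) ∣ a := ⟨_, rfl⟩
  have hd' : (m : ℤ) ∣ a + m := dvd_add hd (dvd_refl _)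
  refine ⟨a, hd, ?_⟩
  have hend : ∀ n, N ≤ n → c (n + 1) ≠ r n → 2 * R n - S ≠ a ∧ 2 * R n - S ≠ a + m := by
    intro n hn h
    rw [hc n hn, hr n, ne_comm, Ne, emod_eq_iff, show R n - (S - R n) = 2 * R n - S by ring] at h
    exact ⟨fun h' => h (h' ▸ hd), fun h' => h (h' ▸ hd')⟩
  have hmid : ∀ n, N ≤ n → c (n + 1) ≠ r (n + 1) →
      R n + R (n + 1) - S ≠ a ∧ R n + R (n + 1) - S ≠ a + m := by
    intro n hn h
    rw [hc n hn, hr (n + 1), ne_comm, Ne, emod_eq_iff,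
      show R (n + 1) - (S - R n) = R n + R (n + 1) - S by ring] at h
    exact ⟨fun h' => h (h' ▸ hd), fun h' => h (h' ▸ hd')⟩
  intro n hn
  induction n, hn using Nat.le_induction with
  | base =>
    intro h
    have h1 := hend N le_rfl (h N le_rfl).2
    have h2 := Int.emod_add_mul_ediv (2 * R N - S) m
    have h3 := Int.emod_nonneg (2 * R N - S) hpos.ne'
    have h4 := Int.emod_lt_of_pos (2 * R N - S) hpos
    omega
  | succ n hn ih =>
    intro h
    have h0 := ih fun k hk => h k (by omega)
    have h1 := hend (n + 1) (by omega) (h (n + 1) le_rfl).2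
    have h2 := hmid n hn (h (n + 1) le_rfl).1
    have h3 := hR n
    omega

/-- Counting the vertices in an open half. -/
lemma half_count (s : Set (Fin m)) (S a : ℤ) (ha : (m : ℤ) ∣ a) (K : ℕ)
    (hK : m ≤ 2 * K ∨ m ≤ 2 * K + 1 ∧ Odd m ∨ m ≤ 2 * K + 2 ∧ Even m ∧ Even S)
    (h : ∀ v ∈ s, ∃ x : ℤ, a < 2 * x - S ∧ 2 * x - S < a + m ∧ v = emod m x) : s.ncard ≤ K := by
  apply ncard_le' s ((S + a) / 2 + 1) ((S + a + m - 1) / 2) K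
  · rcases hK with hK | ⟨hK, hK1⟩ | ⟨hK, hK1, hK2⟩
    · omega
    · obtain ⟨k, rfl⟩ := hK1
      push_cast at *
      omega
    · obtain ⟨k, rfl⟩ := hK1
      obtain ⟨l, rfl⟩ := hK2
      obtain ⟨q, rfl⟩ := ha
      push_cast
      rw [show ((k : ℤ) + k) * q = 2 * (k * q) by ring]
      generalize (k : ℤ) * q = t
      omega
  · intro v hv
    obtain ⟨x, h1, h2, h3⟩ := h v hv
    exact ⟨x, by omega, by omega, h3⟩

/-- Mirroring from the first move on. -/
lemma mirror_bound (hm : 4 ≤ m) (f : Fin m → Fin m) (RS : RobberStrategy (Fin m))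
    (hRS : RS.Legal (cycleGraph m)) (K : ℕ) (x : ℤ) (hx : -1 ≤ x) (hx' : x ≤ 1)
    (hf : f (RS.init (emod m 0)) = emod m x)
    (hK : m ≤ 2 * K ∨ m ≤ 2 * K + 1 ∧ Odd m ∨
      m ≤ 2 * K + 2 ∧ Even m ∧ Even (x + (RS.init (emod m 0)).val)) (g : Fin m → Fin m → Fin m)
    (hg : ∀ r1, g (RS.init (emod m 0)) r1 =
      emod m ((f (RS.init (emod m 0))).val + (RS.init (emod m 0)).val - r1.val)) :
    (damageSet (mirrorCop m f g) RS).ncard ≤ K := by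
  set r0 := RS.init (emod m 0) with hr0
  obtain ⟨R, hR0, hr, hR⟩ := seq_lift hm (robPos (mirrorCop m f g) RS) r0.val
    (by rw [emod_self]; rfl) (rob_step hRS _)
  have h0 : robPos (mirrorCop m f g) RS 0 = r0 := rfl
  have h1 : copPos (mirrorCop m f g) RS 1 = emod m (x + R 0 - R 0) := by
    rw [mirrorCop_one, h0, hf, guardMove_eq hm (by omega) (by omega)]
    congr 1; ring
  have h2 : copPos (mirrorCop m f g) RS 2 = emod m (x + R 0 - R 1) := by
    rw [mirrorCop_two, h0, hg, hr 1, h1, hf]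
    have : emod m ((emod m x).val + r0.val - (emod m (R 1)).val) = emod m (x + R 0 - R 1) := by
      rw [emod_eq_iff, hR0]
      have h1 := emod_val_dvd (m := m) x
      have h3 := emod_val_dvd (m := m) (R 1)
      obtain ⟨w, hw⟩ := dvd_sub h1 h3
      exact ⟨w, by linarith⟩
    rw [this]
    have := hR 0
    rw [zero_add] at this
    exact guardMove_eq hm (by omega) (by omega)
  obtain ⟨a, ha, hconf⟩ := confine (copPos (mirrorCop m f g) RS) _ R hr hR (x + R 0) 0 (by
    intro n _
    rcases n with _ | n
    · exact h1
    · exact mirrorCop_mirror hm f g RS R hr hR _ h2 n)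
  apply half_count _ (x + R 0) a ha K (by rwa [hR0])
  rintro v ⟨n, rfl, hn⟩
  obtain ⟨h3, h4⟩ := hconf n (by omega) hn
  exact ⟨R n, h3, h4, hr n⟩

lemma cop_pass_bound (hm : 4 ≤ m) (K : ℕ) (hK : m ≤ 2 * K ∨ m ≤ 2 * K + 1 ∧ Odd m) :
    ∃ CS : CopStrategy (Fin m), CS.Legal (cycleGraph m) ∧ CS.PassesFirst ∧
      ∀ RS : RobberStrategy (Fin m), RS.Legal (cycleGraph m) → (damageSet CS RS).ncard ≤ K := by
  refine ⟨mirrorCop m (fun _ => emod m 0)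
    (fun r0 r1 => emod m ((emod m 0).val + r0.val - r1.val)), mirrorCop_legal _ _, ?_, ?_⟩
  · intro r
    exact guardMove_eq hm (a := 0) (b := 0) (by omega) (by omega)
  · intro RS hRS
    exact mirror_bound hm _ RS hRS K 0 (by omega) (by omega) rfl (by tauto) _ (fun _ => rfl)

lemma cop_even_bound (hm : 4 ≤ m) (hme : Even m) (K : ℕ) (hK : m ≤ 2 * K + 2) :
    ∃ CS : CopStrategy (Fin m), CS.Legal (cycleGraph m) ∧
      ∀ RS : RobberStrategy (Fin m), RS.Legal (cycleGraph m) → (damageSet CS RS).ncard ≤ K := by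
  let f : Fin m → Fin m := fun r0 => emod m (if Even r0.val then 0 else 1)
  refine ⟨mirrorCop m f
    (fun r0 r1 => emod m ((f r0).val + r0.val - r1.val)), mirrorCop_legal _ _, ?_⟩
  intro RS hRS
  refine mirror_bound hm _ RS hRS K (if Even (RS.init (emod m 0)).val then 0 else 1)
    (by split_ifs <;> omega) (by split_ifs <;> omega) rfl ?_ _ (fun _ => rfl)
  right; right
  refine ⟨hK, hme, ?_⟩
  split_ifs with h
  · rw [zero_add]; exact_mod_cast h
  · rw [Int.even_iff]; rw [Nat.even_iff] at h; omega

lemma cop_third (hm : 4 ≤ m) (hme : Even m) (K : ℕ) (hK : m ≤ 2 * K + 2) :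
    ∃ CS : CopStrategy (Fin m), CS.Legal (cycleGraph m) ∧ CS.PassesFirst ∧
      ∀ RS : RobberStrategy (Fin m), RS.Legal (cycleGraph m) →
        ¬ (cycleGraph m).Adj CS.init (RS.init CS.init) → (damageSet CS RS).ncard ≤ K := by
  let f : Fin m → Fin m := fun _ => emod m 0
  let g : Fin m → Fin m → Fin m := fun r0 r1 =>
    if Even r0.val then emod m ((emod m 0).val + r0.val - r1.val) else
      if Even r1.val then emod m 0 else emod m 1
  refine ⟨mirrorCop m f g, mirrorCop_legal _ _, ?_, ?_⟩
  · intro r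
    exact guardMove_eq hm (a := 0) (b := 0) (by omega) (by omega)
  intro RS hRS hadj
  replace hadj : ¬ (cycleGraph m).Adj (emod m 0) (RS.init (emod m 0)) := hadj
  by_cases hev : Even (RS.init (emod m 0)).val
  · refine mirror_bound hm f RS hRS K 0 (by omega) (by omega) rfl ?_ g ?_
    · right; right
      refine ⟨hK, hme, ?_⟩
      rw [zero_add]; exact_mod_cast hev
    · intro r1
      simp only [g, if_pos hev, f]
  set r0 := RS.init (emod m 0) with hr0
  obtain ⟨R, hR0, hr, hR⟩ := seq_lift hm (robPos (mirrorCop m f g) RS) r0.val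
    (by rw [emod_self]; rfl) (rob_step hRS _)
  have h0 : robPos (mirrorCop m f g) RS 0 = r0 := rfl
  have h1 : copPos (mirrorCop m f g) RS 1 = emod m 0 := by
    rw [mirrorCop_one, guardMove_eq hm (by omega) (by omega)]
  have hR0odd : R 0 % 2 = 1 := by rw [Nat.even_iff] at hev; omega
  obtain ⟨q, hq⟩ := id hme
  have hpar : ∀ z : ℤ, (m : ℤ) ∣ z → z % 2 = 0 := by
    rintro z ⟨w, rfl⟩
    rw [hq]; push_cast
    rw [show ((q : ℤ) + q) * w = 2 * (q * w) by ring]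
    omega
  have hpar1 : Even (emod m (R 1)).val ↔ R 1 % 2 = 0 := by
    have := hpar _ (emod_val_dvd (m := m) (R 1))
    rw [Nat.even_iff]
    omega
  rw [show r0 = emod m (R 0) by rw [hR0, emod_self], adj_emod hm, not_or] at hadj
  obtain ⟨hadj1, hadj2⟩ := hadj
  have hn1 : ¬ (m : ℤ) ∣ R 0 - 1 := by simpa using hadj2
  have hn2 : ¬ (m : ℤ) ∣ R 0 + 1 := by
    rintro ⟨w, hw⟩
    exact hadj1 ⟨-w, by linarith⟩
  have hn3 : ¬ (m : ℤ) ∣ R 0 := fun h => by have := hpar _ h; omega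
  have hR1 := hR 0
  rw [zero_add] at hR1
  have h2g : copPos (mirrorCop m f g) RS 2 =
      guardMove (emod m 0) (if Even (emod m (R 1)).val then emod m 0 else emod m 1) := by
    rw [mirrorCop_two, h0, h1, hr 1]
    simp only [g, if_neg hev]
  -- choose the axis
  obtain ⟨S, hS, hSe, hin⟩ : ∃ S : ℤ, copPos (mirrorCop m f g) RS 2 = emod m (S - R 1) ∧ Even S ∧
      ∀ a : ℤ, (m : ℤ) ∣ a → a < 2 * R 1 - S ∧ 2 * R 1 - S < a + m →
        a < 2 * R 0 - S ∧ 2 * R 0 - S < a + m := by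
    by_cases h : R 1 % 2 = 0
    · refine ⟨R 1, ?_, Int.even_iff.2 h, ?_⟩
      · rw [h2g, if_pos (hpar1.2 h), guardMove_eq hm (by omega) (by omega)]
        congr 1; ring
      · intro a ha h3
        have ha' : (m : ℤ) ∣ a + m := dvd_add ha (dvd_refl _)
        have k1 : R 0 ≠ a := fun h => hn3 (h ▸ ha)
        have k2 : R 0 ≠ a + m := fun h => hn3 (h ▸ ha')
        have k3 : R 0 - 1 ≠ a := fun h => hn1 (h ▸ ha)
        have k4 : R 0 - 1 ≠ a + m := fun h => hn1 (h ▸ ha')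
        have k5 : R 0 + 1 ≠ a := fun h => hn2 (h ▸ ha)
        have k6 : R 0 + 1 ≠ a + m := fun h => hn2 (h ▸ ha')
        omega
    · have h01 : R 1 = R 0 := by omega
      refine ⟨R 1 + 1, ?_, Int.even_iff.2 (by omega), ?_⟩
      · rw [h2g, if_neg (fun h' => h (hpar1.1 h')), guardMove_eq hm (by omega) (by omega)]
        congr 1; ring
      · intro a ha h3
        rwa [← h01]
  obtain ⟨a, ha, hconf⟩ := confine (copPos (mirrorCop m f g) RS) _ R hr hR S 1 (by
    intro n hn
    obtain ⟨n, rfl⟩ := Nat.exists_eq_add_of_le' hn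
    exact mirrorCop_mirror hm f g RS R hr hR _ hS n)
  by_cases hcap : ∀ k ≤ 1, copPos (mirrorCop m f g) RS k ≠ robPos (mirrorCop m f g) RS k ∧
      copPos (mirrorCop m f g) RS (k + 1) ≠ robPos (mirrorCop m f g) RS k
  · apply half_count _ S a ha K (by tauto)
    rintro v ⟨n, rfl, hn⟩
    refine ⟨R n, ?_⟩
    rcases Nat.eq_zero_or_pos n with rfl | hpos
    · obtain ⟨h3, h4⟩ := hin a ha (hconf 1 le_rfl hcap)
      exact ⟨h3, h4, hr 0⟩
    · obtain ⟨h3, h4⟩ := hconf n hpos hn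
      exact ⟨h3, h4, hr n⟩
  · apply ncard_le' _ (R 0) (R 0) K (by omega)
    rintro v ⟨n, rfl, hn⟩
    rcases Nat.eq_zero_or_pos n with rfl | hpos
    · exact ⟨R 0, le_rfl, le_rfl, hr 0⟩
    · exact absurd (fun k hk => hn k (by omega)) hcap

/-! ### Lower bounds -/

/-- The robber that always runs forward, starting next to the cop. -/
def runRobber (m : ℕ) [NeZero m] : RobberStrategy (Fin m) where
  init := fun c => emod m (c.val + 1)
  move := fun _ rh => match rh with
    | r :: _ => emod m (r.val + 1)
    | [] => emod m 0

lemma emod_val_add (x t : ℤ) : emod m ((emod m x).val + t) = emod m (x + t) := by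
  rw [emod_eq_iff]
  obtain ⟨w, hw⟩ := emod_val_dvd (m := m) x
  exact ⟨w, by linarith⟩

lemma emod_val_sub (x t : ℤ) : emod m ((emod m x).val - t) = emod m (x - t) :=
  emod_val_add x (-t)

lemma runRobber_bound (hm : 4 ≤ m) (CS : CopStrategy (Fin m)) (hCS : CS.Legal (cycleGraph m))
    (hp : CS.PassesFirst) : ∃ RS : RobberStrategy (Fin m), RS.Legal (cycleGraph m) ∧
      m / 2 ≤ (damageSet CS RS).ncard := by
  refine ⟨runRobber m, ?_, ?_⟩
  · intro r ch rh
    have := step_emod hm (a := r.val) (b := r.val + 1) (by omega) (by omega)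
    rwa [emod_self] at this
  set c := copPos CS (runRobber m) with hc
  set r := robPos CS (runRobber m) with hr
  obtain ⟨C, hC0, hcC, hC⟩ := seq_lift hm (fun n => c (n + 1)) CS.init.val
    (by rw [emod_self]; exact hp _) (fun n => cop_step hCS _ (n + 1))
  have hc0 : c 0 = emod m (C 0) := by rw [hC0, emod_self]; rfl
  have hrR : ∀ n : ℕ, r n = emod m (C 0 + 1 + n) := by
    intro n
    induction n with
    | zero => rw [hC0]; simp; rfl
    | succ n ih =>
      have : r (n + 1) = emod m ((r n).val + 1) := rfl
      rw [this, ih, emod_val_add]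
      congr 1; push_cast; ring
  have hCb : ∀ n : ℕ, C 0 - n ≤ C n ∧ C n ≤ C 0 + n := by
    intro n
    induction n with
    | zero => simp
    | succ n ih => have := hC n; push_cast; omega
  apply ncard_ge _ (C 0 + 1) (m / 2) (by omega)
  intro i hi
  refine ⟨i, hrR i, ?_⟩
  intro k hk
  have hck : c (k + 1) = emod m (C k) := hcC k
  change c k ≠ r k ∧ c (k + 1) ≠ r k
  rw [hck, hrR k]
  constructor
  · rcases k with _ | k
    · rw [hc0]
      exact emod_ne (by push_cast; omega) (by push_cast; omega)
    · rw [show c (k + 1) = emod m (C k) from hcC k]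
      have := hCb k
      exact emod_ne (by push_cast; omega) (by push_cast; omega)
  · have := hCb k
    exact emod_ne (by omega) (by omega)

open Classical in
/-- The robber that follows a receding cop at distance two and, as soon as the cop stops
receding, runs away forever. -/
noncomputable def followRobber (m : ℕ) [NeZero m] : RobberStrategy (Fin m) where
  init := fun c => emod m (c.val + 2)
  move := fun ch rh => match rh with
    | r :: _ => if List.IsChain (fun a b : Fin m => a = emod m ((b.val : ℤ) - 1)) ch
        then emod m (r.val - 1) else emod m (r.val + 1)
    | [] => emod m 0

lemma followRobber_bound (hm : 4 ≤ m) (CS : CopStrategy (Fin m)) (hCS : CS.Legal (cycleGraph m)) :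
    ∃ RS : RobberStrategy (Fin m), RS.Legal (cycleGraph m) ∧
      (m - 1) / 2 ≤ (damageSet CS RS).ncard := by
  classical
  refine ⟨followRobber m, ?_, ?_⟩
  · intro r ch rh
    have h1 := step_emod hm (a := r.val) (b := r.val + 1) (by omega) (by omega)
    have h2 := step_emod hm (a := r.val) (b := r.val - 1) (by omega) (by omega)
    rw [emod_self] at h1 h2
    simp only [followRobber]
    split_ifs
    · exact h2
    · exact h1
  set c := copPos CS (followRobber m) with hc
  set r := robPos CS (followRobber m) with hr
  have hch : ∀ n, List.IsChain (fun a b : Fin m => a = emod m ((b.val : ℤ) - 1))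
      (c n :: (play CS (followRobber m) n).2.2.1) ↔
      ∀ k < n, c (k + 1) = emod m ((c k).val - 1) := by
    intro n
    induction n with
    | zero => simp [play]
    | succ n ih =>
      have : (play CS (followRobber m) (n + 1)).2.2.1 =
        c n :: (play CS (followRobber m) n).2.2.1 := rfl
      rw [this, List.isChain_cons_cons, ih]
      constructor
      · rintro ⟨h1, h2⟩ k hk
        rcases Nat.lt_succ_iff_lt_or_eq.1 hk with h | rfl
        · exact h2 k h
        · exact h1
      · intro h
        exact ⟨h n (by omega), fun k hk => h k (by omega)⟩
  have hrs : ∀ n, r (n + 1) = if ∀ k < n + 1, c (k + 1) = emod m ((c k).val - 1) then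
      emod m ((r n).val - 1) else emod m ((r n).val + 1) := by
    intro n
    rw [← if_congr (hch (n + 1)) rfl rfl]
    rfl
  set x : ℤ := (CS.init.val : ℤ) with hx
  have hc0 : c 0 = emod m x := by rw [hx, emod_self]; rfl
  have hr0 : r 0 = emod m (x + 2) := rfl
  -- the following phase
  have hfol : ∀ n : ℕ, (∀ k < n, c (k + 1) = emod m ((c k).val - 1)) →
      c n = emod m (x - n) ∧ r n = emod m (x + 2 - n) := by
    intro n
    induction n with
    | zero => intro _; simp [hc0, hr0]
    | succ n ih =>
      intro h
      obtain ⟨h1, h2⟩ := ih fun k hk => h k (by omega)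
      rw [hrs n, if_pos h, h n (by omega), h1, h2, emod_val_sub, emod_val_sub]
      constructor <;> (congr 1; push_cast; ring)
  by_cases hall : ∀ k, c (k + 1) = emod m ((c k).val - 1)
  · -- everything is damaged
    have hsafe : ∀ n, c n ≠ r n ∧ c (n + 1) ≠ r n := by
      intro n
      obtain ⟨h1, h2⟩ := hfol n fun k _ => hall k
      obtain ⟨h3, -⟩ := hfol (n + 1) fun k _ => hall k
      rw [h1, h2, h3]
      exact ⟨emod_ne (by omega) (by omega), emod_ne (by push_cast; omega) (by push_cast; omega)⟩
    apply ncard_ge _ (x + 2 - ((m - 1) / 2 : ℕ)) _ (by omega)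
    intro i hi
    refine ⟨(m - 1) / 2 - i, ?_, fun k _ => hsafe k⟩
    rw [show robPos CS (followRobber m) = r from rfl, (hfol _ fun k _ => hall k).2]
    congr 1
    omega
  · push Not at hall
    have hspec := Nat.find_spec hall
    have hmin : ∀ k < Nat.find hall, c (k + 1) = emod m ((c k).val - 1) := fun k hk => by
      have := Nat.find_min hall hk
      push Not at this
      exact this
    set N := Nat.find hall with hN
    obtain ⟨hcN, hrN⟩ := hfol N hmin
    have hrun : ∀ j : ℕ, r (N + j) = emod m (x + 2 - N + j) := by
      intro j
      induction j with
      | zero => simpa using hrN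
      | succ j ih =>
        rw [← add_assoc, hrs, if_neg (fun h => hspec (h N (by omega))), ih, emod_val_add]
        congr 1; push_cast; ring
    have hstepN : c (N + 1) = c N ∨ (cycleGraph m).Adj (c N) (c (N + 1)) := cop_step hCS _ N
    rw [hcN] at hstepN
    obtain ⟨b, hb1, hb2, hb⟩ := step_lift hm hstepN
    have hb3 : b ≠ x - N - 1 := by
      rintro rfl
      apply hspec
      rw [hcN, emod_val_sub]
      exact hb
    obtain ⟨C, hC0, hcC, hC⟩ := seq_lift hm (fun n => c (N + 1 + n)) b hb
      (fun n => cop_step hCS _ (N + 1 + n))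
    have hCb : ∀ n : ℕ, b - n ≤ C n ∧ C n ≤ b + n := by
      intro n
      induction n with
      | zero => simp [hC0]
      | succ n ih => have := hC n; push_cast; omega
    apply ncard_ge _ (x + 2 - N) _ (by omega)
    intro i hi
    refine ⟨N + i, hrun i, ?_⟩
    intro k hk
    change c k ≠ r k ∧ c (k + 1) ≠ r k
    rcases lt_or_ge k N with hkN | hkN
    · obtain ⟨h1, h2⟩ := hfol k fun l hl => hmin l (by omega)
      obtain ⟨h3, -⟩ := hfol (k + 1) fun l hl => hmin l (by omega)
      rw [h1, h2, h3]
      exact ⟨emod_ne (by omega) (by omega), emod_ne (by push_cast; omega) (by push_cast; omega)⟩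
    · obtain ⟨j, rfl⟩ := Nat.exists_eq_add_of_le hkN
      have e1 : c (N + j + 1) = emod m (C j) := by
        rw [← hcC j]; congr 1; omega
      rw [hrun j, e1]
      constructor
      · rcases j with _ | j
        · rw [add_zero, hcN]
          exact emod_ne (by push_cast; omega) (by push_cast; omega)
        · have e2 : c (N + (j + 1)) = emod m (C j) := by
            rw [← hcC j]; congr 1; omega
          rw [e2]
          have := hCb j
          exact emod_ne (by push_cast; omega) (by push_cast; omega)
      · have := hCb j
        exact emod_ne (by omega) (by omega)

lemma dmg_ge (hm : 4 ≤ m) : (m - 1) / 2 ≤ dmg (cycleGraph m) := by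
  obtain ⟨CS, h1, -, h2⟩ := cop_pass_bound hm m (by omega)
  refine le_csInf (Set.nonempty_of_mem (x := m) ⟨CS, h1, h2⟩) ?_
  rintro n ⟨CS, hCS, h⟩
  obtain ⟨RS, hRS, hle⟩ := followRobber_bound hm CS hCS
  exact hle.trans (h RS hRS)

end aux

/-- For any `m ≥ 4`, `dmg'(C_m) = dmg(C_m)` if `m` is odd and
`dmg'(C_m) = dmg(C_m) + 1` if `m` is even.  Furthermore, when `m` is even, the cop has a
legal strategy that passes in the first round and, provided the robber starts on a vertex
not adjacent to the cop, prevents the robber from damaging more than `dmg(C_m)`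
vertices. -/
theorem dmg'_cycle {m : ℕ} (hm : 4 ≤ m) :
    (Odd m → dmg' (cycleGraph m) = dmg (cycleGraph m)) ∧
      (Even m → dmg' (cycleGraph m) = dmg (cycleGraph m) + 1) ∧
      (Even m → ∃ CS : CopStrategy (Fin m), CS.Legal (cycleGraph m) ∧
        CS.PassesFirst ∧
        ∀ RS : RobberStrategy (Fin m), RS.Legal (cycleGraph m) →
          ¬ (cycleGraph m).Adj CS.init (RS.init CS.init) →
          (damageSet CS RS).ncard ≤ dmg (cycleGraph m)) := by
  have : NeZero m := ⟨by omega⟩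
  have hge := dmg_ge hm
  refine ⟨fun ho => ?_, fun he => ?_, fun he => cop_third hm he _ ?_⟩
  · obtain ⟨CS, h1, h2, h3⟩ := cop_pass_bound hm ((m - 1) / 2)
      (Or.inr ⟨by obtain ⟨k, rfl⟩ := ho; omega, ho⟩)
    have hle' : dmg' (cycleGraph m) ≤ (m - 1) / 2 := Nat.sInf_le ⟨CS, h1, h2, h3⟩
    refine le_antisymm (hle'.trans hge) ?_
    refine le_csInf (Set.nonempty_of_mem ⟨CS, h1, h2, h3⟩) ?_
    rintro n ⟨CS, k1, -, k3⟩
    exact Nat.sInf_le ⟨CS, k1, k3⟩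
  · obtain ⟨k, hk⟩ := id he
    obtain ⟨CS, h1, h2, h3⟩ := cop_pass_bound hm (m / 2) (by omega)
    have hle' : dmg' (cycleGraph m) ≤ m / 2 := Nat.sInf_le ⟨CS, h1, h2, h3⟩
    have hge' : m / 2 ≤ dmg' (cycleGraph m) := by
      refine le_csInf (Set.nonempty_of_mem ⟨CS, h1, h2, h3⟩) ?_
      rintro n ⟨CS, k1, k2, k3⟩
      obtain ⟨RS, hRS, hle⟩ := runRobber_bound hm CS k1 k2
      exact hle.trans (k3 RS hRS)
    obtain ⟨CS', h1', h3'⟩ := cop_even_bound hm he (m / 2 - 1) (by omega)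
    have hle : dmg (cycleGraph m) ≤ m / 2 - 1 := Nat.sInf_le ⟨CS', h1', h3'⟩
    omega
  · obtain ⟨k, hk⟩ := id he
    omega
end
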